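/- Let S = {x ∈ ℝⁿ : Fx ≤ 𝟏} be compact with 0 in its interior and gauge Ψ(x) = max_{1≤j≤p} F_{j,:}x, let A(w) = Σ_i w_i A_i, B(w) = Σ_i w_i B_i for w in the simplex W, and let Φ satisfy the contraction condition Ψ(A(w)x + B(w)Φ(x)) ≤ λΨ(x) on S with λ ∈ (0,1). Let Φ_NN satisfy ‖Φ(x) − Φ_NN(x)‖_∞ ≤ ē for all x ∈ S and set τ = ‖F‖_∞ · max_i ‖B_i‖_∞. Fix ρ ∈ (λ,1) and b ∈ (0,1] with ē ≤ (ρ−λ)b/τ. Then for every x ∈ S with Ψ(x) ≥ b and every w ∈ W, Ψ(A(w)x + B(w)Φ_NN(x)) ≤ ρ Ψ(x). -/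

import Mathlib

/-- The polyhedral set `S = {x ∈ ℝⁿ | F x ≤ 𝟏}` (componentwise). -/
def polySet {p n : ℕ} (F : Matrix (Fin p) (Fin n) ℝ) : Set (Fin n → ℝ) :=
  {x | ∀ j, F.mulVec x j ≤ 1}

/-- The polyhedral gauge function `Ψ(x) = max_{1 ≤ j ≤ p} F_{j,:} x`. -/
noncomputable def gaugeFn {p n : ℕ} (F : Matrix (Fin p) (Fin n) ℝ) (x : Fin n → ℝ) : ℝ :=
  ⨆ j, F.mulVec x j

/-- The uncertainty simplex `W = {w ∈ ℝ^M | Σᵢ wᵢ = 1, w ≥ 0}`. -/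
def simplexW (M : ℕ) : Set (Fin M → ℝ) := {w | ∑ i, w i = 1 ∧ ∀ i, 0 ≤ w i}

/-- The operator norm of a matrix induced by the `∞`-norms (the sup norms on the
function spaces `Fin b → ℝ` and `Fin a → ℝ`). -/
noncomputable def opNormInf {a b : ℕ} (A : Matrix (Fin a) (Fin b) ℝ) : ℝ :=
  ‖LinearMap.toContinuousLinearMap (Matrix.toLin' A)‖

theorem opNormInf_bound {a b : ℕ} (A : Matrix (Fin a) (Fin b) ℝ) (v : Fin b → ℝ) :
    ‖A.mulVec v‖ ≤ opNormInf A * ‖v‖ := by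
  have h := (LinearMap.toContinuousLinearMap (Matrix.toLin' A)).le_opNorm v
  simpa [opNormInf] using h

theorem opNormInf_nonneg {a b : ℕ} (A : Matrix (Fin a) (Fin b) ℝ) : 0 ≤ opNormInf A :=
  norm_nonneg _

theorem sum_bound {n m M : ℕ} (B : Fin M → Matrix (Fin n) (Fin m) ℝ) (w : Fin M → ℝ)
    (hw : w ∈ simplexW M) (v : Fin m → ℝ) :
    ‖(∑ i, w i • B i).mulVec v‖ ≤ (⨆ i, opNormInf (B i)) * ‖v‖ := by
  obtain ⟨h1, h2⟩ := hw
  rw [Matrix.sum_mulVec]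
  calc ‖∑ i, (w i • B i).mulVec v‖ ≤ ∑ i, ‖(w i • B i).mulVec v‖ := norm_sum_le _ _
    _ ≤ ∑ i, w i * ((⨆ i, opNormInf (B i)) * ‖v‖) := by
        apply Finset.sum_le_sum
        intro i _
        rw [Matrix.smul_mulVec, norm_smul, Real.norm_of_nonneg (h2 i)]
        apply mul_le_mul_of_nonneg_left _ (h2 i)
        apply (opNormInf_bound _ _).trans
        apply mul_le_mul_of_nonneg_right _ (norm_nonneg _)
        exact le_ciSup (f := fun i => opNormInf (B i)) (Set.finite_range _).bddAbove i
    _ = _ := by rw [← Finset.sum_mul, h1, one_mul]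

/-- If `Φ` satisfies the contraction condition with factor `λ ∈ (0,1)` on `S`,
`Φ_NN` approximates `Φ` with worst-case `∞`-norm error `ē` on `S`,
`τ = ‖F‖_∞ · maxᵢ ‖Bᵢ‖_∞`, `ρ ∈ (λ,1)`, `b ∈ (0,1]` and `ē ≤ (ρ−λ)b/τ`, then for every
`x ∈ S` with `Ψ(x) ≥ b` and every `w ∈ W`, `Ψ(A(w)x + B(w)Φ_NN(x)) ≤ ρ Ψ(x)`. -/
theorem stmt5 {n m p M : ℕ} (hp : 0 < p) (hM : 0 < M)
    (F : Matrix (Fin p) (Fin n) ℝ)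
    (hcomp : IsCompact (polySet F))
    (h0 : (0 : Fin n → ℝ) ∈ interior (polySet F))
    (A : Fin M → Matrix (Fin n) (Fin n) ℝ) (B : Fin M → Matrix (Fin n) (Fin m) ℝ)
    (Φ ΦNN : (Fin n → ℝ) → (Fin m → ℝ)) (lam ebar τ ρ b : ℝ)
    (hlam0 : 0 < lam) (hlam1 : lam < 1)
    (hΦ : ∀ x ∈ polySet F, ∀ w ∈ simplexW M,
      gaugeFn F ((∑ i, w i • A i).mulVec x + (∑ i, w i • B i).mulVec (Φ x))
        ≤ lam * gaugeFn F x)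
    (herr : ∀ x ∈ polySet F, ‖Φ x - ΦNN x‖ ≤ ebar)
    (hτ : τ = opNormInf F * ⨆ i, opNormInf (B i))
    (hρ1 : lam < ρ) (hρ2 : ρ < 1)
    (hb0 : 0 < b) (hb1 : b ≤ 1)
    (hebar : ebar ≤ (ρ - lam) * b / τ) :
    ∀ x ∈ polySet F, b ≤ gaugeFn F x → ∀ w ∈ simplexW M,
      gaugeFn F ((∑ i, w i • A i).mulVec x + (∑ i, w i • B i).mulVec (ΦNN x))
        ≤ ρ * gaugeFn F x := by
  intro x hx hbx w hw
  have : Nonempty (Fin p) := ⟨⟨0, hp⟩⟩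
  have hs : 0 ≤ ⨆ i, opNormInf (B i) := Real.iSup_nonneg fun i => opNormInf_nonneg _
  have hτ0 : 0 ≤ τ := hτ ▸ mul_nonneg (opNormInf_nonneg F) hs
  have hτe : τ * ebar ≤ (ρ - lam) * b := by
    rcases hτ0.eq_or_lt with h | h
    · rw [← h, zero_mul]
      exact mul_nonneg (by linarith) hb0.le
    · rw [le_div_iff₀ h] at hebar
      linarith
  have hpsi : (ρ - lam) * b ≤ (ρ - lam) * gaugeFn F x :=
    mul_le_mul_of_nonneg_left hbx (by linarith)
  apply ciSup_le
  intro j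
  have hj : F.mulVec ((∑ i, w i • A i).mulVec x + (∑ i, w i • B i).mulVec (Φ x)) j
      ≤ lam * gaugeFn F x :=
    (le_ciSup (f := fun j => F.mulVec ((∑ i, w i • A i).mulVec x
      + (∑ i, w i • B i).mulVec (Φ x)) j) (Set.finite_range _).bddAbove j).trans (hΦ x hx w hw)
  have he : ‖F.mulVec ((∑ i, w i • B i).mulVec (Φ x - ΦNN x))‖ ≤ τ * ebar := by
    apply (opNormInf_bound _ _).trans
    rw [hτ, mul_assoc]
    apply mul_le_mul_of_nonneg_left _ (opNormInf_nonneg F)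
    exact (sum_bound B w hw _).trans (mul_le_mul_of_nonneg_left (herr x hx) hs)
  have hej := (norm_le_pi_norm _ j).trans he
  rw [Real.norm_eq_abs, abs_le] at hej
  have h1 := hej.1
  simp only [Matrix.mulVec_sub, Matrix.mulVec_add, Pi.add_apply, Pi.sub_apply] at h1 hj ⊢
  linarith
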